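/- Let n, m be positive integers and let R be a probability distribution on {0, ..., min{n,m}}. For i = 1, 2, consider the probability space Ωᵢ = F_q^{n×m} × GL(n,q) × F_q^{n×m} equipped with the product of the input distribution pᵢ, the uniform distribution on GL(n,q), and the Uniform Given Rank distribution with rank distribution R; let Xᵢ be the first coordinate, Aᵢ the second, Bᵢ the third, and Yᵢ = Aᵢ(Xᵢ + Bᵢ). Suppose p₁ is an arbitrary probability distribution on F_q^{n×m} and p₂ is the Uniform Given Rank distribution whose rank distribution equals that of p₁ (i.e. Σ_{M : rank(M)=r} p₁(M) = Σ_{M : rank(M)=r} p₂(M) for all r). Then the mutual informations satisfy I(X₂; Y₂) ≥ I(X₁; Y₁). Consequently, a capacity-achieving input distribution for the Gamma channel Γ(R) can always be taken to be Uniform Given Rank. -/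

import Mathlib

/-- The Shannon entropy of a probability distribution `p` on a finite type `S`:
`H(p) = -∑_{s ∈ S} p(s) log p(s)` (with the convention `0 · log 0 = 0`, which holds
automatically since `Real.log 0 = 0`). -/
noncomputable def shannonEntropy {S : Type*} [Fintype S] (p : S → ℝ) : ℝ :=
  -∑ s : S, p s * Real.log (p s)

/-- The distribution of `A(M + B)` where `A` is uniform on `GL(n,q)` and `B` has
distribution `pB`, independent of `A`: the matrix `M` is fixed.  On the product space
this is the conditional distribution of the output `Y = A(X + B)` given `X = M`. -/
noncomputable def outputDist {F : Type*} [Field F] [Fintype F] [DecidableEq F]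
    {n m : ℕ} (pB : Matrix (Fin n) (Fin m) F → ℝ) (M : Matrix (Fin n) (Fin m) F) :
    Matrix (Fin n) (Fin m) F → ℝ := fun Y =>
  ∑ A₀ : GL (Fin n) F, ∑ B₀ : Matrix (Fin n) (Fin m) F,
    (if (A₀ : Matrix (Fin n) (Fin n) F) * (M + B₀) = Y then
      (1 / (Fintype.card (GL (Fin n) F) : ℝ)) * pB B₀ else 0)

/-- The distribution of the Gamma channel output `Y = A(X + B)` when the input `X` has
distribution `p`, `A` is uniform on `GL(n,q)` and `B` has distribution `pB`, all
independent. -/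
noncomputable def channelOutputDist {F : Type*} [Field F] [Fintype F] [DecidableEq F]
    {n m : ℕ} (p pB : Matrix (Fin n) (Fin m) F → ℝ) :
    Matrix (Fin n) (Fin m) F → ℝ := fun Y =>
  ∑ x : Matrix (Fin n) (Fin m) F, p x * outputDist pB x Y

/-- The mutual information `I(X; Y) = H(Y) − H(Y | X)` between the input `X` (with
distribution `p`) and the output `Y = A(X + B)` of the Gamma channel, where `H(Y | X) =
∑_x Prob(X = x) · H(Y | X = x)`. -/
noncomputable def mutualInfo {F : Type*} [Field F] [Fintype F] [DecidableEq F]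
    {n m : ℕ} (p pB : Matrix (Fin n) (Fin m) F → ℝ) : ℝ :=
  shannonEntropy (channelOutputDist p pB) -
    ∑ x : Matrix (Fin n) (Fin m) F, p x * shannonEntropy (outputDist pB x)

/-- Two linear maps with the same rank between finite-dimensional spaces are equivalent. -/
theorem LinearMap.exists_linearEquiv_comp_eq_of_finrank_range_eq {K V W : Type*} [Field K]
    [AddCommGroup V] [Module K V] [FiniteDimensional K V]
    [AddCommGroup W] [Module K W] [FiniteDimensional K W] (f g : V →ₗ[K] W)
    (h : Module.finrank K (LinearMap.range f) = Module.finrank K (LinearMap.range g)) :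
    ∃ (σ : V ≃ₗ[K] V) (τ : W ≃ₗ[K] W), ∀ x, τ (f x) = g (σ x) := by
  have hf := f.finrank_range_add_finrank_ker
  have hg := g.finrank_range_add_finrank_ker
  have hker : Module.finrank K (LinearMap.ker f) = Module.finrank K (LinearMap.ker g) := by omega
  obtain ⟨σ, hσ⟩ := Submodule.exists_linearEquiv_restrict_eq
    (LinearEquiv.ofFinrankEq (LinearMap.ker f) (LinearMap.ker g) hker)
  set k : V →ₗ[K] W := g ∘ₗ σ.toLinearMap with hk
  have hle : LinearMap.ker f ≤ LinearMap.ker k := by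
    intro x hx
    have := (LinearEquiv.ofFinrankEq (LinearMap.ker f) (LinearMap.ker g) hker ⟨x, hx⟩).2
    rw [hσ] at this
    simpa [hk] using this
  have hrange : LinearMap.range k = LinearMap.range g :=
    LinearMap.range_comp_of_range_eq_top _ (LinearEquiv.range σ)
  have hkk := k.finrank_range_add_finrank_ker
  have hker' : LinearMap.ker f = LinearMap.ker k :=
    Submodule.eq_of_le_of_finrank_eq hle (by rw [hrange] at hkk; omega)
  obtain ⟨τ, hτ⟩ := Submodule.exists_linearEquiv_restrict_eq
    (f.quotKerEquivRange.symm ≪≫ₗ Submodule.quotEquivOfEq _ _ hker' ≪≫ₗ k.quotKerEquivRange)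
  refine ⟨σ, τ, fun x => ?_⟩
  have hx : f.quotKerEquivRange.symm ⟨f x, LinearMap.mem_range_self f x⟩ =
      (LinearMap.ker f).mkQ x := f.quotKerEquivRange_symm_apply_image x _
  rw [← hτ ⟨f x, LinearMap.mem_range_self f x⟩]
  simp [hx, hk]

/-- Matrices of the same rank are equivalent. -/
theorem Matrix.exists_units_mul_mul_eq_of_rank_eq {K : Type*} [Field K] {n m : Type*}
    [Fintype n] [DecidableEq n] [Fintype m] [DecidableEq m] {M N : Matrix n m K}
    (h : M.rank = N.rank) :
    ∃ (P : GL n K) (Q : GL m K), (P : Matrix n n K) * M * (Q : Matrix m m K) = N := by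
  obtain ⟨σ, τ, hστ⟩ := LinearMap.exists_linearEquiv_comp_eq_of_finrank_range_eq
    M.mulVecLin N.mulVecLin h
  obtain ⟨P, hP⟩ := LinearMap.isUnit_toMatrix'_iff.mpr
    ((Module.End.isUnit_iff τ.toLinearMap).mpr τ.bijective)
  obtain ⟨Q, hQ⟩ := LinearMap.isUnit_toMatrix'_iff.mpr
    ((Module.End.isUnit_iff σ.symm.toLinearMap).mpr σ.symm.bijective)
  refine ⟨P, Q, Matrix.toLin'.injective (LinearMap.ext fun x => ?_)⟩
  have := hστ (σ.symm x)
  simp only [LinearEquiv.apply_symm_apply] at this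
  rw [hP, hQ, Matrix.toLin'_mul, Matrix.toLin'_mul, Matrix.toLin'_toMatrix',
    Matrix.toLin'_toMatrix']
  simpa using this

theorem Matrix.rank_units_mul_mul {K : Type*} [Field K] {n m : Type*}
    [Fintype n] [DecidableEq n] [Fintype m] [DecidableEq m] (P : GL n K) (Q : GL m K)
    (M : Matrix n m K) : ((P : Matrix n n K) * M * (Q : Matrix m m K)).rank = M.rank := by
  rw [Matrix.rank_mul_eq_left_of_isUnit_det _ _ ((Matrix.isUnit_iff_isUnit_det _).mp Q.isUnit),
    Matrix.rank_mul_eq_right_of_isUnit_det _ _ ((Matrix.isUnit_iff_isUnit_det _).mp P.isUnit)]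

/-- Two-sided multiplication by invertible matrices, as a permutation of the matrix space. -/
def Matrix.unitsMulMulPerm {K : Type*} [Field K] {n m : Type*}
    [Fintype n] [DecidableEq n] [Fintype m] [DecidableEq m] (P : GL n K) (Q : GL m K) :
    Equiv.Perm (Matrix n m K) where
  toFun M := (P : Matrix n n K) * M * (Q : Matrix m m K)
  invFun M := ((P⁻¹ : GL n K) : Matrix n n K) * M * ((Q⁻¹ : GL m K) : Matrix m m K)
  left_inv M := by
    beta_reduce
    rw [Matrix.mul_assoc (P : Matrix n n K), ← Matrix.mul_assoc _ (P : Matrix n n K),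
      Units.inv_mul, Matrix.one_mul, Matrix.mul_assoc, Units.mul_inv, Matrix.mul_one]
  right_inv M := by
    beta_reduce
    rw [Matrix.mul_assoc ((P⁻¹ : GL n K) : Matrix n n K), ← Matrix.mul_assoc (P : Matrix n n K),
      Units.mul_inv, Matrix.one_mul, Matrix.mul_assoc, Units.inv_mul, Matrix.mul_one]

/-- The transition probabilities are invariant under simultaneous two-sided multiplication of
input and output by invertible matrices. -/
theorem outputDist_unitsMulMulPerm {F : Type*} [Field F] [Fintype F] [DecidableEq F] {n m : ℕ}
    {pB : Matrix (Fin n) (Fin m) F → ℝ}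
    (hpB : ∀ M M' : Matrix (Fin n) (Fin m) F, M.rank = M'.rank → pB M = pB M')
    (P : GL (Fin n) F) (Q : GL (Fin m) F) (M Y : Matrix (Fin n) (Fin m) F) :
    outputDist pB (Matrix.unitsMulMulPerm P Q M) (Matrix.unitsMulMulPerm P Q Y) =
      outputDist pB M Y := by
  unfold outputDist
  symm
  refine Fintype.sum_equiv (MulAut.conj P).toEquiv _ _ fun A => ?_
  refine Fintype.sum_equiv (Matrix.unitsMulMulPerm P Q) _ _ fun B => ?_
  have hB : pB (Matrix.unitsMulMulPerm P Q B) = pB B := hpB _ _ (Matrix.rank_units_mul_mul P Q B)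
  have hA : ((MulAut.conj P A : GL (Fin n) F) : Matrix (Fin n) (Fin n) F) *
      (Matrix.unitsMulMulPerm P Q M + Matrix.unitsMulMulPerm P Q B) =
        Matrix.unitsMulMulPerm P Q ((A : Matrix (Fin n) (Fin n) F) * (M + B)) := by
    simp only [Matrix.unitsMulMulPerm, Equiv.coe_fn_mk, MulAut.conj_apply, Units.val_mul]
    rw [← Matrix.add_mul, ← Matrix.mul_add, Matrix.mul_assoc (P : Matrix (Fin n) (Fin n) F) (M + B),
      Matrix.mul_assoc _ ((P⁻¹ : GL (Fin n) F) : Matrix (Fin n) (Fin n) F),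
      ← Matrix.mul_assoc ((P⁻¹ : GL (Fin n) F) : Matrix (Fin n) (Fin n) F), Units.inv_mul,
      Matrix.one_mul]
    simp only [Matrix.mul_assoc]
  simp only [MulEquiv.toEquiv_eq_coe, MulEquiv.coe_toEquiv, hA, hB, EmbeddingLike.apply_eq_iff_eq]

theorem outputDist_nonneg {F : Type*} [Field F] [Fintype F] [DecidableEq F] {n m : ℕ}
    {pB : Matrix (Fin n) (Fin m) F → ℝ} (hpB : ∀ M, 0 ≤ pB M) (M Y : Matrix (Fin n) (Fin m) F) :
    0 ≤ outputDist pB M Y := by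
  refine Finset.sum_nonneg fun A _ => Finset.sum_nonneg fun B _ => ?_
  split_ifs
  · exact mul_nonneg (by positivity) (hpB B)
  · exact le_rfl

theorem shannonEntropy_eq_sum_negMulLog {S : Type*} [Fintype S] (p : S → ℝ) :
    shannonEntropy p = ∑ s, Real.negMulLog (p s) := by
  simp [shannonEntropy, Real.negMulLog, Finset.sum_neg_distrib]

theorem shannonEntropy_comp_equiv {S T : Type*} [Fintype S] [Fintype T] (e : S ≃ T) (p : T → ℝ) :
    shannonEntropy (fun s => p (e s)) = shannonEntropy p := by
  unfold shannonEntropy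
  rw [← e.sum_comp fun t => p t * Real.log (p t)]

/-- Averaging a nonnegative function over a finite group action does not decrease its entropy. -/
theorem shannonEntropy_le_of_average {G S : Type*} [Group G] [Fintype G] [MulAction G S]
    [Fintype S] {p p' : S → ℝ} (hp : ∀ s, 0 ≤ p s)
    (hp' : ∀ s, p' s = ∑ g : G, (Fintype.card G : ℝ)⁻¹ * p (g • s)) :
    shannonEntropy p ≤ shannonEntropy p' := by
  have hcard : (Fintype.card G : ℝ) ≠ 0 := by simp
  have hsum (x : ℝ) : ∑ _g : G, (Fintype.card G : ℝ)⁻¹ * x = x := by simp [hcard]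
  calc shannonEntropy p
      = ∑ g : G, (Fintype.card G : ℝ)⁻¹ * ∑ s, Real.negMulLog (p (g • s)) := by
        rw [← hsum (shannonEntropy p)]
        refine Finset.sum_congr rfl fun g _ => ?_
        rw [← shannonEntropy_comp_equiv (MulAction.toPerm g) p, shannonEntropy_eq_sum_negMulLog]
        rfl
    _ = ∑ s, ∑ g : G, (Fintype.card G : ℝ)⁻¹ * Real.negMulLog (p (g • s)) := by
        simp_rw [Finset.mul_sum]
        exact Finset.sum_comm
    _ ≤ ∑ s, Real.negMulLog (p' s) := by
        refine Finset.sum_le_sum fun s _ => ?_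
        rw [hp']
        exact Real.concaveOn_negMulLog.le_map_sum (fun _ _ => by positivity)
          (by simp) (fun g _ => hp (g • s))
    _ = shannonEntropy p' := (shannonEntropy_eq_sum_negMulLog p').symm

/-- Functions with the same sum on every fibre of `r` have the same sum against any function that
is constant on the fibres. -/
theorem sum_mul_eq_sum_mul_of_fiber_sums_eq {S ι : Type*} [Fintype S] [DecidableEq ι] {r : S → ι}
    {p p' h : S → ℝ}
    (hpp' : ∀ i, (∑ s, if r s = i then p s else 0) = ∑ s, if r s = i then p' s else 0)
    (hh : ∀ s t, r s = r t → h s = h t) : ∑ s, p s * h s = ∑ s, p' s * h s := by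
  have key (f : S → ℝ) : ∑ s, f s * h s = ∑ i ∈ Finset.univ.image r,
      ∑ s with r s = i, f s * h s :=
    (Finset.sum_fiberwise_of_maps_to (fun s _ => Finset.mem_image_of_mem r (Finset.mem_univ s))
      _).symm
  rw [key, key]
  refine Finset.sum_congr rfl fun i hi => ?_
  obtain ⟨t, -, rfl⟩ := Finset.mem_image.mp hi
  have fiber (f : S → ℝ) :
      ∑ s with r s = r t, f s * h s = (∑ s, if r s = r t then f s else 0) * h t := by
    rw [← Finset.sum_filter, Finset.sum_mul]
    refine Finset.sum_congr rfl fun s hs => ?_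
    rw [hh s t (Finset.mem_filter.mp hs).2]
  rw [fiber, fiber, hpp']

/-- If the orbits of a finite group are the fibres of `r`, then the function that is constant on
the fibres and has the same fibre sums as `p` is the group average of `p`. -/
theorem eq_average_of_fiber_sums_eq {G S ι : Type*} [Group G] [Fintype G] [MulAction G S]
    [Fintype S] [DecidableEq ι] {r : S → ι} (hr : ∀ (g : G) s, r (g • s) = r s)
    (htrans : ∀ s t, r s = r t → ∃ g : G, g • s = t) {p p' : S → ℝ}
    (hpp' : ∀ i, (∑ s, if r s = i then p s else 0) = ∑ s, if r s = i then p' s else 0)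
    (hp' : ∀ s t, r s = r t → p' s = p' t) (s : S) :
    p' s = ∑ g : G, (Fintype.card G : ℝ)⁻¹ * p (g • s) := by
  have hcard : (Fintype.card G : ℝ) ≠ 0 := by simp
  set a : S → ℝ := fun s => ∑ g : G, (Fintype.card G : ℝ)⁻¹ * p (g • s) with ha
  have ha_const (s t : S) (hst : r s = r t) : a s = a t := by
    obtain ⟨h, rfl⟩ := htrans s t hst
    simp only [ha, smul_smul]
    exact (Equiv.sum_comp (Equiv.mulRight h) fun g => (Fintype.card G : ℝ)⁻¹ * p (g • s)).symm
  have ha_sum : (∑ t, if r t = r s then a t else 0) = ∑ t, if r t = r s then p t else 0 := by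
    calc (∑ t, if r t = r s then a t else 0)
        = ∑ g : G, (Fintype.card G : ℝ)⁻¹ * ∑ t, if r t = r s then p (g • t) else 0 := by
          simp_rw [Finset.mul_sum, mul_ite, mul_zero]
          rw [Finset.sum_comm]
          refine Finset.sum_congr rfl fun t _ => ?_
          split_ifs <;> simp [ha]
      _ = ∑ _g : G, (Fintype.card G : ℝ)⁻¹ * ∑ t, if r t = r s then p t else 0 := by
          refine Finset.sum_congr rfl fun g _ => ?_
          congr 1
          rw [← Equiv.sum_comp (MulAction.toPerm g) fun t => if r t = r s then p t else 0]
          simp [hr]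
      _ = ∑ t, if r t = r s then p t else 0 := by simp [hcard]
  have hconst (f : S → ℝ) (hf : ∀ s t, r s = r t → f s = f t) :
      (∑ t, if r t = r s then f t else 0) = (Finset.univ.filter fun t => r t = r s).card * f s := by
    rw [← Finset.sum_filter, Finset.sum_congr rfl fun t ht => hf t s (Finset.mem_filter.mp ht).2]
    simp
  have hpos : ((Finset.univ.filter fun t => r t = r s).card : ℝ) ≠ 0 := by
    rw [Nat.cast_ne_zero]
    exact Finset.card_ne_zero_of_mem (Finset.mem_filter.mpr ⟨Finset.mem_univ s, rfl⟩)
  refine mul_left_cancel₀ hpos ?_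
  rw [← hconst p' hp', ← hconst a ha_const, ha_sum, hpp']

/-- For a channel `W` whose symmetry group acts transitively on the fibres of `r`, symmetrizing
the input distribution along the fibres does not decrease the output entropy. -/
theorem shannonEntropy_mixture_le_of_symmetric {S ι : Type*} [Fintype S] [DecidableEq ι]
    {r : S → ι} (G : Subgroup (Equiv.Perm S)) (hr : ∀ g ∈ G, ∀ s, r (g s) = r s)
    (htrans : ∀ s t, r s = r t → ∃ g ∈ G, g s = t) {W : S → S → ℝ} (hW0 : ∀ s t, 0 ≤ W s t)
    (hW : ∀ g ∈ G, ∀ s t, W (g s) (g t) = W s t) {p p' : S → ℝ} (hp : ∀ s, 0 ≤ p s)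
    (hpp' : ∀ i, (∑ s, if r s = i then p s else 0) = ∑ s, if r s = i then p' s else 0)
    (hp' : ∀ s t, r s = r t → p' s = p' t) :
    shannonEntropy (fun t => ∑ s, p s * W s t) ≤ shannonEntropy (fun t => ∑ s, p' s * W s t) := by
  classical
  have := Fintype.ofFinite G
  refine shannonEntropy_le_of_average (G := G)
    (fun t => Finset.sum_nonneg fun s _ => mul_nonneg (hp s) (hW0 s t)) fun t => ?_
  have havg := eq_average_of_fiber_sums_eq (G := G) (fun g s => hr g g.2 s)
    (fun s t hst => by
      obtain ⟨g, hg, rfl⟩ := htrans s t hst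
      exact ⟨⟨g, hg⟩, rfl⟩) hpp' hp'
  simp_rw [havg, Finset.sum_mul]
  rw [Finset.sum_comm]
  refine Finset.sum_congr rfl fun g _ => ?_
  rw [← Equiv.sum_comp (MulAction.toPerm g) fun s => p s * W s (g • t), Finset.mul_sum]
  refine Finset.sum_congr rfl fun s _ => ?_
  have hg : W (g • s) (g • t) = W s t := hW g g.2 s t
  rw [MulAction.toPerm_apply, hg, mul_assoc]

/-- for the Gamma channel `Γ(R)`, replacing an arbitrary input
distribution `p₁` by the Uniform Given Rank input distribution `p₂` with the same rank
distribution does not decrease the mutual information; hence a capacity-achieving input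
distribution can be taken to be UGR. -/
theorem UGR_input_achieves_capacity
    (q n m : ℕ) (hn : 0 < n) (hm : 0 < m)
    (F : Type*) [Field F] [Fintype F] [DecidableEq F] (hq : Fintype.card F = q)
    -- `R` is a probability distribution on `{0, 1, ..., min n m}`
    (R : ℕ → ℝ) (hR0 : ∀ i, 0 ≤ R i)
    (hR1 : ∑ i ∈ Finset.range (min n m + 1), R i = 1)
    (hRsupp : ∀ i, min n m < i → R i = 0)
    -- `pB` is the UGR distribution with rank distribution `R`: the distribution of `B`
    (pB : Matrix (Fin n) (Fin m) F → ℝ)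
    (hpB : ∀ M : Matrix (Fin n) (Fin m) F,
      pB M = R M.rank /
        (Nat.card {M' : Matrix (Fin n) (Fin m) F // M'.rank = M.rank} : ℝ))
    -- `p₁` is an arbitrary input distribution
    (p₁ : Matrix (Fin n) (Fin m) F → ℝ) (hp₁0 : ∀ M, 0 ≤ p₁ M)
    (hp₁1 : ∑ M : Matrix (Fin n) (Fin m) F, p₁ M = 1)
    -- `p₂` is the UGR input distribution with the same rank distribution as `p₁`
    (p₂ : Matrix (Fin n) (Fin m) F → ℝ) (hp₂0 : ∀ M, 0 ≤ p₂ M)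
    (hp₂1 : ∑ M : Matrix (Fin n) (Fin m) F, p₂ M = 1)
    (hp₂UGR : ∀ M M' : Matrix (Fin n) (Fin m) F, M.rank = M'.rank → p₂ M = p₂ M')
    (hsame : ∀ r : ℕ,
      (∑ M : Matrix (Fin n) (Fin m) F, if M.rank = r then p₁ M else 0) =
        ∑ M : Matrix (Fin n) (Fin m) F, if M.rank = r then p₂ M else 0) :
    mutualInfo p₂ pB ≥ mutualInfo p₁ pB := by
  have hpB0 (M : Matrix (Fin n) (Fin m) F) : 0 ≤ pB M := by
    rw [hpB]
    exact div_nonneg (hR0 _) (Nat.cast_nonneg _)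
  have hpB_rank (M M' : Matrix (Fin n) (Fin m) F) (h : M.rank = M'.rank) : pB M = pB M' := by
    rw [hpB, hpB, h]
  let G : Subgroup (Equiv.Perm (Matrix (Fin n) (Fin m) F)) :=
    { carrier := {g | (∀ M, (g M).rank = M.rank) ∧
        ∀ M Y, outputDist pB (g M) (g Y) = outputDist pB M Y}
      one_mem' := ⟨fun _ => rfl, fun _ _ => rfl⟩
      mul_mem' := fun {a b} ha hb => ⟨fun M => (ha.1 (b M)).trans (hb.1 M),
        fun M Y => (ha.2 (b M) (b Y)).trans (hb.2 M Y)⟩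
      inv_mem' := fun {a} ha => ⟨fun M => by simpa using (ha.1 (a⁻¹ M)).symm,
        fun M Y => by simpa using (ha.2 (a⁻¹ M) (a⁻¹ Y)).symm⟩ }
  have htrans (M N : Matrix (Fin n) (Fin m) F) (h : M.rank = N.rank) : ∃ g ∈ G, g M = N := by
    obtain ⟨P, Q, hPQ⟩ := Matrix.exists_units_mul_mul_eq_of_rank_eq h
    exact ⟨Matrix.unitsMulMulPerm P Q, ⟨Matrix.rank_units_mul_mul P Q,
      outputDist_unitsMulMulPerm hpB_rank P Q⟩, hPQ⟩
  have hcond : ∑ M, p₁ M * shannonEntropy (outputDist pB M) =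
      ∑ M, p₂ M * shannonEntropy (outputDist pB M) := by
    refine sum_mul_eq_sum_mul_of_fiber_sums_eq hsame fun M N h => ?_
    obtain ⟨g, hg, rfl⟩ := htrans M N h
    rw [← shannonEntropy_comp_equiv g (outputDist pB (g M))]
    simp_rw [hg.2]
  have hout : shannonEntropy (channelOutputDist p₁ pB) ≤
      shannonEntropy (channelOutputDist p₂ pB) :=
    shannonEntropy_mixture_le_of_symmetric G (fun g hg => hg.1) htrans (outputDist_nonneg hpB0)
      (fun g hg => hg.2) hp₁0 hsame hp₂UGR
  unfold mutualInfo
  rw [hcond]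
  linarith
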